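/- The projection in Bayes space of p = c·exp(-φ(x)) onto the indefinite-Gaussian subspace G with Gaussian measure ν = N(μ, Σ) equals, up to normalization, exp( −(x−μ)ᵀ E_ν[∂φ/∂xᵀ] − (1/2)(x−μ)ᵀ E_ν[∂²φ/∂xᵀ∂x] (x−μ) ). -/

import Mathlib

open MeasureTheory Real Matrix

noncomputable section

/-- The Bayes-space inner product `⟨p₁,p₂⟩ = E_ν[ln p₁ ln p₂] − E_ν[ln p₁]E_ν[ln p₂]`. -/
def bip {X : Type*} [MeasurableSpace X] (ν : Measure X) (p q : X → ℝ) : ℝ :=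
  (∫ x, Real.log (p x) * Real.log (q x) ∂ν) -
    (∫ x, Real.log (p x) ∂ν) * (∫ x, Real.log (q x) ∂ν)

/-- The Gaussian measure `N(μ, Σ)` on `ℝᴺ`, given by its density w.r.t. Lebesgue measure. -/
def gaussPi (N : ℕ) (μ : Fin N → ℝ) (S : Matrix (Fin N) (Fin N) ℝ) : Measure (Fin N → ℝ) :=
  volume.withDensity fun x => ENNReal.ofReal
    ((Real.sqrt ((2 * π) ^ N * S.det))⁻¹ *
      Real.exp (-(1 / 2) * ((x - μ) ⬝ᵥ S⁻¹.mulVec (x - μ))))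

/-- First block of the orthonormal indefinite-Gaussian basis:
`g₁ᵢ(x) = exp (-(L⁻¹(x−μ))ᵢ)`. -/
def gOne (N : ℕ) (μ : Fin N → ℝ) (L : Matrix (Fin N) (Fin N) ℝ) (i : Fin N) :
    (Fin N → ℝ) → ℝ :=
  fun x => Real.exp (-(L⁻¹.mulVec (x - μ)) i)

/-- Second block of the orthonormal indefinite-Gaussian basis:
`g₂ₖ(x) = exp (-(√((1/2)DᵀD)·vech (L⁻¹(x−μ)(x−μ)ᵀL⁻ᵀ))ₖ)`, where `R = √((1/2)DᵀD)` and
`vech` is the half-vectorization. -/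
def gTwo (N M : ℕ) (μ : Fin N → ℝ) (L : Matrix (Fin N) (Fin N) ℝ)
    (vech : Matrix (Fin N) (Fin N) ℝ → Fin M → ℝ) (R : Matrix (Fin M) (Fin M) ℝ)
    (k : Fin M) : (Fin N → ℝ) → ℝ :=
  fun x => Real.exp (-(R.mulVec (vech (L⁻¹ * vecMulVec (x - μ) (x - μ) * (L⁻¹)ᵀ))) k)

open Filter Topology

/-- Smooth compactly supported cutoffs tending to `1`, with uniformly bounded derivatives
tending to `0`. -/
lemma exists_cutoff_seq (E : Type*) [NormedAddCommGroup E] [NormedSpace ℝ E]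
    [FiniteDimensional ℝ E] :
    ∃ (χ : ℕ → E → ℝ) (C : ℝ), (∀ n, ContDiff ℝ 1 (χ n)) ∧ (∀ n, HasCompactSupport (χ n)) ∧
      (∀ n x, |χ n x| ≤ 1) ∧ (∀ n x, ‖fderiv ℝ (χ n) x‖ ≤ C) ∧
      (∀ x, Tendsto (fun n => χ n x) atTop (𝓝 1)) ∧
      (∀ x, Tendsto (fun n => fderiv ℝ (χ n) x) atTop (𝓝 0)) := by
  let f : ContDiffBump (0 : E) := ⟨1, 2, one_pos, one_lt_two⟩
  have hf : ContDiff ℝ 1 f := f.contDiff (n := 1)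
  obtain ⟨C, hC⟩ := (hf.continuous_fderiv one_ne_zero).bounded_above_of_compact_support
    (f.hasCompactSupport.fderiv ℝ)
  have hC0 : 0 ≤ C := (norm_nonneg _).trans (hC 0)
  let r : ℕ → ℝ := fun n => 1 / ((n : ℝ) + 1)
  have hr0 : ∀ n, 0 < r n := fun n => Nat.one_div_pos_of_nat
  have hr1 : ∀ n, r n ≤ 1 := fun n => by
    have : (1 : ℝ) ≤ n + 1 := by linarith [n.cast_nonneg (α := ℝ)]
    exact div_le_one_of_le₀ this (by positivity)
  have hr : Tendsto r atTop (𝓝 0) := tendsto_one_div_add_atTop_nhds_zero_nat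
  have hb : ∀ n x, ‖fderiv ℝ (fun y => f (r n • y)) x‖ ≤ r n * C := fun n x => by
    rw [fderiv_comp_smul, norm_smul, Real.norm_of_nonneg (hr0 n).le]
    exact mul_le_mul_of_nonneg_left (hC _) (hr0 n).le
  refine ⟨fun n x => f (r n • x), C, fun n => hf.comp (contDiff_const_smul _),
    fun n => f.hasCompactSupport.comp_smul (hr0 n).ne', fun n x => ?_, fun n x => ?_,
    fun x => ?_, fun x => ?_⟩
  · rw [abs_of_nonneg f.nonneg]
    exact f.le_one
  · exact (hb n x).trans (mul_le_of_le_one_left hC0 (hr1 n))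
  · have h0 : f (0 : E) = 1 := f.one_of_mem_closedBall (by simp [f])
    have h : Tendsto (fun n => r n • x) atTop (𝓝 0) := by simpa using hr.smul_const x
    exact h0 ▸ (f.continuous.tendsto (0 : E)).comp h
  · exact squeeze_zero_norm (hb · x) (by simpa using hr.mul_const C)

/-- The density of `gaussPi N μ (L * Lᵀ)`, written in the whitened coordinates `L⁻¹(x−μ)`. -/
def gaussDensity (N : ℕ) (μ : Fin N → ℝ) (L : Matrix (Fin N) (Fin N) ℝ) (x : Fin N → ℝ) : ℝ :=
  (√((2 * π) ^ N * (L * Lᵀ).det))⁻¹ * Real.exp (-(1 / 2) * ∑ i, (L⁻¹.mulVec (x - μ)) i ^ 2)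

lemma apply_eq_sum_single {ι : Type*} [Fintype ι] [DecidableEq ι] (ℓ : (ι → ℝ) →L[ℝ] ℝ)
    (v : ι → ℝ) : ℓ v = ∑ i, v i * ℓ (Pi.single i 1) := by
  conv_lhs => rw [pi_eq_sum_univ' v, map_sum]
  simp

section Gaussian

variable {N : ℕ} (μ : Fin N → ℝ) {L : Matrix (Fin N) (Fin N) ℝ}

lemma gaussPi_eq_withDensity (L : Matrix (Fin N) (Fin N) ℝ) :
    gaussPi N μ (L * Lᵀ) =
      volume.withDensity fun x => ENNReal.ofReal (gaussDensity N μ L x) := by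
  have h : ∀ v : Fin N → ℝ, v ⬝ᵥ (L * Lᵀ)⁻¹.mulVec v = ∑ i, (L⁻¹.mulVec v) i ^ 2 := fun v => by
    rw [Matrix.mul_inv_rev, ← Matrix.transpose_nonsing_inv, ← mulVec_mulVec, dotProduct_mulVec,
      vecMul_transpose, dotProduct]
    exact Finset.sum_congr rfl fun i _ => (sq _).symm
  simp only [gaussPi, gaussDensity, h]

lemma contDiff_whiten (L : Matrix (Fin N) (Fin N) ℝ) (i : Fin N) {n : WithTop ℕ∞} :
    ContDiff ℝ n (fun x : Fin N → ℝ => (L⁻¹.mulVec (x - μ)) i) := by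
  simp only [mulVec, dotProduct, Pi.sub_apply]
  fun_prop

lemma hasFDerivAt_whiten (L : Matrix (Fin N) (Fin N) ℝ) (i : Fin N) (x : Fin N → ℝ) :
    HasFDerivAt (fun x : Fin N → ℝ => (L⁻¹.mulVec (x - μ)) i)
      (LinearMap.toContinuousLinearMap (LinearMap.proj i ∘ₗ Matrix.toLin' L⁻¹)) x := by
  have h := (LinearMap.toContinuousLinearMap
    (LinearMap.proj i ∘ₗ Matrix.toLin' L⁻¹)).hasFDerivAt.comp x ((hasFDerivAt_id x).sub_const μ)
  simpa [Function.comp_def] using h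

lemma fderiv_whiten_apply (hL : IsUnit L.det) (i j : Fin N) (x : Fin N → ℝ) :
    fderiv ℝ (fun x : Fin N → ℝ => (L⁻¹.mulVec (x - μ)) i) x (L.col j) =
      (1 : Matrix (Fin N) (Fin N) ℝ) i j := by
  rw [(hasFDerivAt_whiten μ L i x).fderiv, ← Matrix.nonsing_inv_mul L hL]
  simp [mulVec, Matrix.mul_apply, dotProduct]

lemma continuous_gaussDensity (L : Matrix (Fin N) (Fin N) ℝ) :
    Continuous (gaussDensity N μ L) := by
  have := fun i => (contDiff_whiten μ L i (n := 1)).continuous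
  unfold gaussDensity
  fun_prop

lemma gaussDensity_nonneg (L : Matrix (Fin N) (Fin N) ℝ) (x : Fin N → ℝ) :
    0 ≤ gaussDensity N μ L x := by
  unfold gaussDensity
  positivity

lemma fderiv_gaussDensity_apply (hL : IsUnit L.det) (j : Fin N) (x : Fin N → ℝ) :
    DifferentiableAt ℝ (gaussDensity N μ L) x ∧
    fderiv ℝ (gaussDensity N μ L) x (L.col j) =
      -((L⁻¹.mulVec (x - μ)) j * gaussDensity N μ L x) := by
  have h : HasFDerivAt (gaussDensity N μ L) _ x :=
    (((HasFDerivAt.fun_sum fun i (_ : i ∈ Finset.univ) =>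
      (((contDiff_whiten μ L i (n := 1)).differentiable one_ne_zero x).hasFDerivAt.pow 2)).const_mul
        (-(1 / 2))).exp).const_mul _
  refine ⟨h.differentiableAt, ?_⟩
  rw [h.fderiv]
  simp [fderiv_whiten_apply μ hL, Matrix.one_apply, gaussDensity]
  ring

lemma integrable_gaussPi_iff {f : (Fin N → ℝ) → ℝ} :
    Integrable f (gaussPi N μ (L * Lᵀ)) ↔ Integrable (fun x => f x * gaussDensity N μ L x) := by
  rw [gaussPi_eq_withDensity, integrable_withDensity_iff_integrable_smul'
    (continuous_gaussDensity μ L).measurable.ennreal_ofReal (by simp)]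
  simp [ENNReal.toReal_ofReal (gaussDensity_nonneg μ L _), mul_comm]

lemma integral_gaussPi (f : (Fin N → ℝ) → ℝ) :
    ∫ x, f x ∂(gaussPi N μ (L * Lᵀ)) = ∫ x, f x * gaussDensity N μ L x := by
  rw [gaussPi_eq_withDensity, integral_withDensity_eq_integral_toReal_smul
    (continuous_gaussDensity μ L).measurable.ennreal_ofReal (by simp)]
  simp [ENNReal.toReal_ofReal (gaussDensity_nonneg μ L _), mul_comm]

lemma map_whiten_volume (hL : IsUnit L.det) :
    Measure.map (fun x : Fin N → ℝ => L⁻¹.mulVec (x - μ)) volume =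
      ENNReal.ofReal |L.det| • volume := by
  have hdet : (L⁻¹).det ≠ 0 := by
    rw [Matrix.det_nonsing_inv, Ring.inverse_eq_inv]
    exact inv_ne_zero hL.ne_zero
  have h := Real.map_matrix_volume_pi_eq_smul_volume_pi hdet
  rw [Matrix.det_nonsing_inv, Ring.inverse_eq_inv, inv_inv] at h
  rw [← h, ← (measurePreserving_sub_right (volume : Measure (Fin N → ℝ)) μ).map_eq,
    Measure.map_map (LinearMap.continuous_of_finiteDimensional _).measurable (by fun_prop),
    (measurePreserving_sub_right (volume : Measure (Fin N → ℝ)) μ).map_eq]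
  rfl

lemma integrable_exp_neg_mul_sum_sq {b : ℝ} (hb : 0 < b) :
    Integrable (fun z : Fin N → ℝ => Real.exp (-b * ∑ i, z i ^ 2)) := by
  simp_rw [Finset.mul_sum, Real.exp_sum]
  exact Integrable.fintype_prod fun _ => integrable_exp_neg_mul_sq hb

lemma integrable_exp_neg_mul_whiten (hL : IsUnit L.det) {b : ℝ} (hb : 0 < b) :
    Integrable (fun x : Fin N → ℝ => Real.exp (-b * ∑ i, (L⁻¹.mulVec (x - μ)) i ^ 2)) := by
  have h := (integrable_exp_neg_mul_sum_sq (N := N) hb).smul_measure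
    (ENNReal.ofReal_ne_top (r := |L.det|))
  rw [← map_whiten_volume μ hL] at h
  exact h.comp_measurable (by fun_prop)

lemma integral_gaussDensity (hL : IsUnit L.det) : ∫ x, gaussDensity N μ L x = 1 := by
  have hc : Continuous (fun z : Fin N → ℝ => Real.exp (-(1 / 2) * ∑ i, z i ^ 2)) := by fun_prop
  have h := integral_map (μ := volume) (φ := fun x : Fin N → ℝ => L⁻¹.mulVec (x - μ))
    (by fun_prop) hc.aestronglyMeasurable
  have h1 : ∫ z : Fin N → ℝ, Real.exp (-(1 / 2) * ∑ i, z i ^ 2) = √(2 * π) ^ N := by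
    simp_rw [Finset.mul_sum, Real.exp_sum]
    rw [integral_fintype_prod_volume_eq_pow (fun t : ℝ => Real.exp (-(1 / 2) * t ^ 2)),
      integral_gaussian, Fintype.card_fin]
    congr 2
    ring
  rw [map_whiten_volume μ hL, integral_smul_measure, h1,
    ENNReal.toReal_ofReal (abs_nonneg _), smul_eq_mul] at h
  have h2 : √((2 * π) ^ N * (L * Lᵀ).det) = |L.det| * √(2 * π) ^ N := by
    have : (2 * π) ^ N * (L * Lᵀ).det = (|L.det| * √(2 * π) ^ N) ^ 2 := by
      rw [Matrix.det_mul, Matrix.det_transpose, mul_pow |L.det|, sq_abs, ← pow_mul, mul_comm N,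
        pow_mul √(2 * π), Real.sq_sqrt (by positivity)]
      ring
    rw [this, Real.sqrt_sq (by positivity)]
  have h3 : |L.det| * √(2 * π) ^ N ≠ 0 :=
    mul_ne_zero (abs_ne_zero.2 hL.ne_zero) (by positivity)
  simp only [gaussDensity]
  rw [integral_const_mul, ← h, h2, inv_mul_cancel₀ h3]

lemma isProbabilityMeasure_gaussPi (hL : IsUnit L.det) :
    IsProbabilityMeasure (gaussPi N μ (L * Lᵀ)) := by
  have hi : Integrable (gaussDensity N μ L) :=
    (integrable_exp_neg_mul_whiten μ hL one_half_pos).const_mul _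
  constructor
  rw [gaussPi_eq_withDensity, withDensity_apply _ MeasurableSet.univ, Measure.restrict_univ,
    ← ofReal_integral_eq_lintegral_ofReal hi (ae_of_all _ (gaussDensity_nonneg μ L)),
    integral_gaussDensity μ hL, ENNReal.ofReal_one]

lemma integrable_gaussPi_of_abs_le (hL : IsUnit L.det) {f : (Fin N → ℝ) → ℝ} (hf : Continuous f)
    {C : ℝ} (hC : ∀ x, |f x| ≤ C * Real.exp (1 / 4 * ∑ i, (L⁻¹.mulVec (x - μ)) i ^ 2)) :
    Integrable f (gaussPi N μ (L * Lᵀ)) := by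
  rw [integrable_gaussPi_iff]
  refine ((integrable_exp_neg_mul_whiten μ hL (b := 1 / 4) (by norm_num)).const_mul
    (C * (√((2 * π) ^ N * (L * Lᵀ).det))⁻¹)).mono'
    (hf.mul (continuous_gaussDensity μ L)).aestronglyMeasurable (ae_of_all _ fun x => ?_)
  rw [Real.norm_eq_abs, abs_mul, abs_of_nonneg (gaussDensity_nonneg μ L x)]
  refine (mul_le_mul_of_nonneg_right (hC x) (gaussDensity_nonneg μ L x)).trans_eq ?_
  rw [gaussDensity, mul_mul_mul_comm, ← Real.exp_add]
  congr 2
  ring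

lemma integrable_whiten_mul_whiten (hL : IsUnit L.det) (i j : Fin N) :
    Integrable (fun x => (L⁻¹.mulVec (x - μ)) i * (L⁻¹.mulVec (x - μ)) j)
      (gaussPi N μ (L * Lᵀ)) := by
  refine integrable_gaussPi_of_abs_le μ hL (C := 4) ((contDiff_whiten μ L i (n := 1)).continuous.mul
    (contDiff_whiten μ L j (n := 1)).continuous) fun x => ?_
  set z := L⁻¹.mulVec (x - μ)
  have hi : z i ^ 2 ≤ ∑ k, z k ^ 2 :=
    Finset.single_le_sum (f := fun k => z k ^ 2) (fun k _ => sq_nonneg _) (Finset.mem_univ i)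
  have hj : z j ^ 2 ≤ ∑ k, z k ^ 2 :=
    Finset.single_le_sum (f := fun k => z k ^ 2) (fun k _ => sq_nonneg _) (Finset.mem_univ j)
  have he := Real.add_one_le_exp (1 / 4 * ∑ k, z k ^ 2)
  have h := two_mul_le_add_sq |z i| |z j|
  rw [sq_abs, sq_abs] at h
  rw [abs_mul]
  linarith

lemma integrable_whiten (hL : IsUnit L.det) (i : Fin N) :
    Integrable (fun x => (L⁻¹.mulVec (x - μ)) i) (gaussPi N μ (L * Lᵀ)) := by
  have := isProbabilityMeasure_gaussPi μ hL
  have h : MemLp (fun x => (L⁻¹.mulVec (x - μ)) i) 2 (gaussPi N μ (L * Lᵀ)) := by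
    rw [memLp_two_iff_integrable_sq
      (contDiff_whiten μ L i (n := 1)).continuous.aestronglyMeasurable]
    simpa only [sq] using integrable_whiten_mul_whiten μ hL i i
  exact h.integrable one_le_two

/-- Stein's identity. -/
lemma integral_fderiv_gaussPi (hL : IsUnit L.det) (i : Fin N) {f : (Fin N → ℝ) → ℝ}
    (hf : Differentiable ℝ f) (h0 : Integrable f (gaussPi N μ (L * Lᵀ)))
    (h1 : Integrable (fun x => (L⁻¹.mulVec (x - μ)) i * f x) (gaussPi N μ (L * Lᵀ)))
    (h2 : Integrable (fun x => fderiv ℝ f x (L.col i)) (gaussPi N μ (L * Lᵀ))) :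
    ∫ x, fderiv ℝ f x (L.col i) ∂(gaussPi N μ (L * Lᵀ)) =
      ∫ x, (L⁻¹.mulVec (x - μ)) i * f x ∂(gaussPi N μ (L * Lᵀ)) := by
  rw [integrable_gaussPi_iff] at h0 h1 h2
  have hd := fun x => (fderiv_gaussDensity_apply μ hL i x).2
  have he : ∀ x, f x * fderiv ℝ (gaussDensity N μ L) x (L.col i) =
      -((L⁻¹.mulVec (x - μ)) i * f x * gaussDensity N μ L x) := fun x => by
    rw [hd]
    ring
  have h := integral_mul_fderiv_eq_neg_fderiv_mul_of_integrable h2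
    (by simp only [he]; exact h1.neg) h0 (fun x _ => hf x)
    (fun x _ => (fderiv_gaussDensity_apply μ hL i x).1)
  simp only [he, integral_neg, neg_inj] at h
  rw [integral_gaussPi, integral_gaussPi, h]

lemma integral_whiten (hL : IsUnit L.det) (i : Fin N) :
    ∫ x, (L⁻¹.mulVec (x - μ)) i ∂(gaussPi N μ (L * Lᵀ)) = 0 := by
  have := isProbabilityMeasure_gaussPi μ hL
  have h := integral_fderiv_gaussPi μ hL i (f := fun _ => 1) (by fun_prop) (integrable_const _)
    (by simpa using integrable_whiten μ hL i) (by simp)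
  simpa using h.symm

lemma integral_whiten_mul_whiten (hL : IsUnit L.det) (i j : Fin N) :
    ∫ x, (L⁻¹.mulVec (x - μ)) i * (L⁻¹.mulVec (x - μ)) j ∂(gaussPi N μ (L * Lᵀ)) =
      (1 : Matrix (Fin N) (Fin N) ℝ) i j := by
  have := isProbabilityMeasure_gaussPi μ hL
  have h := integral_fderiv_gaussPi μ hL i
    ((contDiff_whiten μ L j (n := 1)).differentiable one_ne_zero)
    (integrable_whiten μ hL j) (integrable_whiten_mul_whiten μ hL i j)
    (by simp [fderiv_whiten_apply μ hL])
  simpa [fderiv_whiten_apply μ hL, Matrix.one_apply, eq_comm] using h.symm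

lemma integral_fderiv_gaussPi_of_hasCompactSupport (hL : IsUnit L.det) (i : Fin N)
    {f : (Fin N → ℝ) → ℝ} (hf : ContDiff ℝ 1 f) (hc : HasCompactSupport f) :
    ∫ x, fderiv ℝ f x (L.col i) ∂(gaussPi N μ (L * Lᵀ)) =
      ∫ x, (L⁻¹.mulVec (x - μ)) i * f x ∂(gaussPi N μ (L * Lᵀ)) := by
  have := isProbabilityMeasure_gaussPi μ hL
  refine integral_fderiv_gaussPi μ hL i (hf.differentiable one_ne_zero)
    (hf.continuous.integrable_of_hasCompactSupport hc)
    (((contDiff_whiten μ L i (n := 1)).continuous.mul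
      hf.continuous).integrable_of_hasCompactSupport hc.mul_left) ?_
  exact ((hf.continuous_fderiv one_ne_zero).clm_apply
    continuous_const).integrable_of_hasCompactSupport (hc.fderiv_apply ℝ _)

/-- Second-order Stein identity. No integrability of the mixed terms `L⁻¹(x−μ)ᵢ ∂φ` is needed. -/
lemma integral_fderiv_fderiv_gaussPi (hL : IsUnit L.det) (i j : Fin N) {φ : (Fin N → ℝ) → ℝ}
    (hφ : ContDiff ℝ 2 φ) (h0 : Integrable φ (gaussPi N μ (L * Lᵀ)))
    (h1 : ∀ i, Integrable (fun x => (L⁻¹.mulVec (x - μ)) i * φ x) (gaussPi N μ (L * Lᵀ)))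
    (h2 : Integrable (fun x => (L⁻¹.mulVec (x - μ)) i * (L⁻¹.mulVec (x - μ)) j * φ x)
      (gaussPi N μ (L * Lᵀ)))
    (h3 : Integrable (fun x => fderiv ℝ φ x (L.col j)) (gaussPi N μ (L * Lᵀ)))
    (h4 : Integrable (fun x => fderiv ℝ (fun y => fderiv ℝ φ y (L.col j)) x (L.col i))
      (gaussPi N μ (L * Lᵀ))) :
    ∫ x, fderiv ℝ (fun y => fderiv ℝ φ y (L.col j)) x (L.col i) ∂(gaussPi N μ (L * Lᵀ)) =
      ∫ x, (L⁻¹.mulVec (x - μ)) i * (L⁻¹.mulVec (x - μ)) j * φ x ∂(gaussPi N μ (L * Lᵀ)) -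
      (1 : Matrix (Fin N) (Fin N) ℝ) i j * ∫ x, φ x ∂(gaussPi N μ (L * Lᵀ)) := by
  have := isProbabilityMeasure_gaussPi μ hL
  set ν := gaussPi N μ (L * Lᵀ)
  set z : Fin N → (Fin N → ℝ) → ℝ := fun i x => (L⁻¹.mulVec (x - μ)) i
  set ψ : (Fin N → ℝ) → ℝ := fun y => fderiv ℝ φ y (L.col j) with hψ_def
  have hzC : ∀ i, ContDiff ℝ 1 (z i) := fun i => contDiff_whiten μ L i
  have hφ1 : ContDiff ℝ 1 φ := hφ.of_le one_le_two
  have hψ : ContDiff ℝ 1 ψ := (hφ.fderiv_right (m := 1) (by norm_num)).clm_apply contDiff_const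
  obtain ⟨χ, C, hχ, hχc, hχ1, hχC, hχt, hχt'⟩ := exists_cutoff_seq (Fin N → ℝ)
  have hχd : ∀ n, Differentiable ℝ (χ n) := fun n => (hχ n).differentiable one_ne_zero
  have hχ' : ∀ n k, Continuous fun x => fderiv ℝ (χ n) x (L.col k) := fun n k =>
    ((hχ n).continuous_fderiv one_ne_zero).clm_apply continuous_const
  have lim1 : ∀ {f : (Fin N → ℝ) → ℝ}, Integrable f ν →
      Tendsto (fun n => ∫ x, χ n x * f x ∂ν) atTop (𝓝 (∫ x, f x ∂ν)) := fun {f} hf => by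
    refine tendsto_integral_of_dominated_convergence (fun x => ‖f x‖)
      (fun n => (hχ n).continuous.aestronglyMeasurable.mul hf.aestronglyMeasurable) hf.norm
      (fun n => ae_of_all _ fun x => ?_) (ae_of_all _ fun x => ?_)
    · rw [norm_mul]
      exact mul_le_of_le_one_left (norm_nonneg _) (hχ1 n x)
    · simpa using (hχt x).mul_const (f x)
  have lim0 : ∀ {f : (Fin N → ℝ) → ℝ} (k : Fin N), Integrable f ν →
      Tendsto (fun n => ∫ x, fderiv ℝ (χ n) x (L.col k) * f x ∂ν) atTop (𝓝 0) := fun {f} k hf => by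
    rw [← integral_zero (Fin N → ℝ) ℝ (μ := ν)]
    refine tendsto_integral_of_dominated_convergence (fun x => C * ‖L.col k‖ * ‖f x‖)
      (fun n => (hχ' n k).aestronglyMeasurable.mul hf.aestronglyMeasurable)
      (hf.norm.const_mul _) (fun n => ae_of_all _ fun x => ?_) (ae_of_all _ fun x => ?_)
    · rw [norm_mul]
      exact mul_le_mul_of_nonneg_right (((fderiv ℝ (χ n) x).le_opNorm _).trans
        (mul_le_mul_of_nonneg_right (hχC n x) (norm_nonneg _))) (norm_nonneg _)
    · have h : Tendsto (fun n => fderiv ℝ (χ n) x (L.col k)) atTop (𝓝 0) :=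
        (((ContinuousLinearMap.apply ℝ ℝ (L.col k)).continuous.tendsto 0).comp (hχt' x)).trans_eq
          (by simp)
      simpa using h.mul_const (f x)
  have int1 : ∀ {f : (Fin N → ℝ) → ℝ} (n : ℕ), Integrable f ν →
      Integrable (fun x => χ n x * f x) ν := fun {f} n hf =>
    hf.bdd_mul (hχ n).continuous.aestronglyMeasurable (ae_of_all _ (hχ1 n))
  have int0 : ∀ {f : (Fin N → ℝ) → ℝ} (n : ℕ) (k : Fin N), Integrable f ν →
      Integrable (fun x => fderiv ℝ (χ n) x (L.col k) * f x) ν := fun {f} n k hf =>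
    hf.bdd_mul (hχ' n k).aestronglyMeasurable (ae_of_all _ fun x =>
      ((fderiv ℝ (χ n) x).le_opNorm _).trans
        (mul_le_mul_of_nonneg_right (hχC n x) (norm_nonneg _)))
  have h1' : ∀ i, Integrable (fun x => z i x * φ x) ν := h1
  obtain ⟨δ, hδ⟩ : ∃ δ : ℝ, ∀ x, fderiv ℝ (z i) x (L.col j) = δ :=
    ⟨_, fderiv_whiten_apply μ hL i j⟩
  rw [← fderiv_whiten_apply μ hL i j 0, hδ 0]
  have key : ∀ n, (∫ x, χ n x * fderiv ℝ ψ x (L.col i) ∂ν) +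
        ∫ x, fderiv ℝ (χ n) x (L.col i) * ψ x ∂ν =
      ((∫ x, χ n x * (z i x * z j x * φ x) ∂ν) -
        δ * ∫ x, χ n x * φ x ∂ν) -
        ∫ x, fderiv ℝ (χ n) x (L.col j) * (z i x * φ x) ∂ν := fun n => by
    have e1 := integral_fderiv_gaussPi_of_hasCompactSupport μ hL i ((hχ n).mul hψ)
      (hχc n).mul_right
    have e2 := integral_fderiv_gaussPi_of_hasCompactSupport μ hL j
      ((hχ n).mul ((hzC i).mul hφ1)) (hχc n).mul_right
    have d1 : ∀ x, fderiv ℝ (fun x => χ n x * ψ x) x (L.col i) =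
        χ n x * fderiv ℝ ψ x (L.col i) + fderiv ℝ (χ n) x (L.col i) * ψ x := fun x => by
      rw [fderiv_fun_mul (hχd n x) (hψ.differentiable one_ne_zero x)]
      simp
      ring
    have d2 : ∀ x, fderiv ℝ (fun x => χ n x * (z i x * φ x)) x (L.col j) =
        δ * (χ n x * φ x) + z i x * (χ n x * ψ x) +
          fderiv ℝ (χ n) x (L.col j) * (z i x * φ x) := fun x => by
      have hzd := (hzC i).differentiable one_ne_zero x
      have hφd := hφ1.differentiable one_ne_zero x
      rw [fderiv_fun_mul (hχd n x) (hzd.fun_mul hφd), fderiv_fun_mul hzd hφd]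
      simp only [_root_.add_apply, _root_.smul_apply, smul_eq_mul, hδ, hψ_def]
      ring
    have i3 : Integrable (fun x => z i x * (χ n x * ψ x)) ν :=
      ((hzC i).continuous.mul ((hχ n).continuous.mul
        hψ.continuous)).integrable_of_hasCompactSupport (hχc n).mul_right.mul_left
    have i2 : Integrable (fun x => δ * (χ n x * φ x) + z i x * (χ n x * ψ x)) ν :=
      ((int1 n h0).const_mul _).add i3
    simp only [d1] at e1
    simp only [d2] at e2
    rw [integral_add (int1 n h4) (int0 n i h3)] at e1
    rw [integral_add i2 (int0 n j (h1' i)),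
      integral_add ((int1 n h0).const_mul _) i3, integral_const_mul] at e2
    have e3 : ∫ x, z j x * (χ n x * (z i x * φ x)) ∂ν = ∫ x, χ n x * (z i x * z j x * φ x) ∂ν :=
      integral_congr_ae (ae_of_all _ fun x => by ring)
    linarith
  have l1 := (lim1 h4).add (lim0 i h3)
  have l2 := ((lim1 h2).sub ((lim1 h0).const_mul
    (δ))).sub (lim0 j (h1' i))
  simp only [key] at l1
  simpa using tendsto_nhds_unique l1 l2

lemma integral_fderiv_col_gaussPi {φ : (Fin N → ℝ) → ℝ}
    (h : ∀ j, Integrable (fun x => fderiv ℝ φ x (Pi.single j 1)) (gaussPi N μ (L * Lᵀ)))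
    (v : Fin N → ℝ) :
    Integrable (fun x => fderiv ℝ φ x v) (gaussPi N μ (L * Lᵀ)) ∧
    ∫ x, fderiv ℝ φ x v ∂(gaussPi N μ (L * Lᵀ)) =
      ∑ j, v j * ∫ x, fderiv ℝ φ x (Pi.single j 1) ∂(gaussPi N μ (L * Lᵀ)) := by
  simp only [fun x => apply_eq_sum_single (fderiv ℝ φ x) v]
  refine ⟨integrable_finsetSum _ fun j _ => (h j).const_mul _, ?_⟩
  rw [integral_finsetSum _ fun j _ => (h j).const_mul _]
  simp only [integral_const_mul]

lemma integral_fderiv_fderiv_col_gaussPi {φ : (Fin N → ℝ) → ℝ} (hφ : ContDiff ℝ 2 φ)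
    (h : ∀ i j, Integrable
      (fun x => fderiv ℝ (fun y => fderiv ℝ φ y (Pi.single j 1)) x (Pi.single i 1))
      (gaussPi N μ (L * Lᵀ))) (v w : Fin N → ℝ) :
    Integrable (fun x => fderiv ℝ (fun y => fderiv ℝ φ y w) x v) (gaussPi N μ (L * Lᵀ)) ∧
    ∫ x, fderiv ℝ (fun y => fderiv ℝ φ y w) x v ∂(gaussPi N μ (L * Lᵀ)) =
      v ⬝ᵥ (Matrix.of fun i j => ∫ y,
        fderiv ℝ (fun z => fderiv ℝ φ z (Pi.single j 1)) y (Pi.single i 1)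
          ∂(gaussPi N μ (L * Lᵀ))).mulVec w := by
  have hd : ∀ j : Fin N, Differentiable ℝ fun y => fderiv ℝ φ y (Pi.single j 1) := fun j =>
    ((hφ.fderiv_right (m := 1) (by norm_num)).clm_apply contDiff_const).differentiable one_ne_zero
  have e : ∀ x, fderiv ℝ (fun y => fderiv ℝ φ y w) x v = ∑ i, ∑ j, v i * (w j *
      fderiv ℝ (fun y => fderiv ℝ φ y (Pi.single j 1)) x (Pi.single i 1)) := fun x => by
    simp only [fun x => apply_eq_sum_single (fderiv ℝ φ x) w]
    rw [apply_eq_sum_single (fderiv ℝ _ x) v,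
      fderiv_fun_sum fun j _ => (hd j x).const_mul (w j)]
    simp only [fderiv_const_mul (hd _ x), _root_.sum_apply, _root_.smul_apply, smul_eq_mul,
      Finset.mul_sum]
  have hi : ∀ i j, Integrable (fun x => v i * (w j *
      fderiv ℝ (fun y => fderiv ℝ φ y (Pi.single j 1)) x (Pi.single i 1)))
      (gaussPi N μ (L * Lᵀ)) := fun i j => ((h i j).const_mul _).const_mul _
  simp only [e]
  refine ⟨integrable_finsetSum _ fun i _ => integrable_finsetSum _ fun j _ => hi i j, ?_⟩
  rw [integral_finsetSum _ fun i _ => integrable_finsetSum _ fun j _ => hi i j]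
  simp only [integral_finsetSum _ fun j _ => hi _ j, integral_const_mul, dotProduct, mulVec,
    Matrix.of_apply, Finset.mul_sum]
  exact Finset.sum_congr rfl fun i _ => Finset.sum_congr rfl fun j _ => by ring

end Gaussian

section Vech

variable {N M : ℕ} {vech : Matrix (Fin N) (Fin N) ℝ → Fin M → ℝ}
  {D : Matrix (Fin N × Fin N) (Fin M) ℝ} {R : Matrix (Fin M) (Fin M) ℝ}

/-- When `M = N (N + 1) / 2`, a one-sided inverse `vech` of the duplication matrix on symmetric
matrices is linear there. -/
lemma exists_vech_eq_mulVec (hM : M = N * (N + 1) / 2)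
    (hD : ∀ A : Matrix (Fin N) (Fin N) ℝ, A.IsSymm →
      ∀ ij : Fin N × Fin N, (D.mulVec (vech A)) ij = A ij.1 ij.2) :
    ∃ T : Matrix (Fin M) (Fin N × Fin N) ℝ, ∀ A : Matrix (Fin N) (Fin N) ℝ, A.IsSymm →
      vech A = T.mulVec fun ij => A ij.1 ij.2 := by
  have hout : ∀ s : Sym2 (Fin N), ∃ p : Fin N × Fin N, s(p.1, p.2) = s :=
    Sym2.ind fun i j => ⟨(i, j), rfl⟩
  choose out hout using hout
  let S : Sym2 (Fin N) → Matrix (Fin N) (Fin N) ℝ := fun s =>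
    Matrix.of fun i j => if s(i, j) = s then 1 else 0
  have hS : ∀ s, (S s).IsSymm := fun s => by
    ext i j
    simp [S, Sym2.eq_swap]
  let F : Matrix (Fin M) (Sym2 (Fin N)) ℝ := Matrix.of fun k s => vech (S s) k
  let K : Matrix (Sym2 (Fin N)) (Fin M) ℝ := Matrix.of fun s k => D (out s) k
  have hKF : K * F = 1 := by
    ext s t
    have h := hD (S t) (hS t) (out s)
    simpa [S, hout, Matrix.one_apply, Matrix.mul_apply, K, F, mulVec, dotProduct] using h
  have hcard : Fintype.card (Sym2 (Fin N)) = Fintype.card (Fin M) := by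
    rw [Sym2.card, Fintype.card_fin, Fintype.card_fin, hM, Nat.choose_two_right,
      Nat.add_sub_cancel, mul_comm]
  have hFK : F * K = 1 := (Matrix.mul_eq_one_comm_of_card_eq _ _ _ hcard).1 hKF
  refine ⟨F * Matrix.of fun s ij => if out s = ij then (1 : ℝ) else 0, fun A hA => ?_⟩
  rw [← mulVec_mulVec, ← Matrix.one_mulVec (vech A), ← hFK, ← mulVec_mulVec]
  congr 1
  ext s
  simpa [K, mulVec, dotProduct] using hD A hA (out s)

lemma dotProduct_mulVec_vech
    (hD : ∀ A : Matrix (Fin N) (Fin N) ℝ, A.IsSymm →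
      ∀ ij : Fin N × Fin N, (D.mulVec (vech A)) ij = A ij.1 ij.2)
    (hR : R * R = (2⁻¹ : ℝ) • (Dᵀ * D)) (hRs : R.IsSymm)
    {A B : Matrix (Fin N) (Fin N) ℝ} (hA : A.IsSymm) (hB : B.IsSymm) :
    R.mulVec (vech A) ⬝ᵥ R.mulVec (vech B) = 2⁻¹ * ∑ i, ∑ j, A i j * B i j := by
  have h : R.mulVec (vech A) ⬝ᵥ R.mulVec (vech B) =
      2⁻¹ * (D.mulVec (vech A) ⬝ᵥ D.mulVec (vech B)) := by
    conv_lhs => rw [dotProduct_comm, dotProduct_mulVec, ← mulVec_transpose, hRs.eq, mulVec_mulVec,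
      hR, smul_mulVec, smul_dotProduct, ← mulVec_mulVec, mulVec_transpose, ← dotProduct_mulVec,
      smul_eq_mul, dotProduct_comm]
  rw [h, dotProduct, Fintype.sum_prod_type]
  simp only [hD A hA, hD B hB]

end Vech

/-- For log-linear arguments the Bayes-space inner product is the covariance of the exponents. -/
lemma bip_exp_neg {X : Type*} [MeasurableSpace X] (ν : Measure X) [IsProbabilityMeasure ν]
    {q φ : X → ℝ} {c : ℝ} (hc : 0 < c) (hq : Integrable q ν) (hφ : Integrable φ ν)
    (hqφ : Integrable (fun x => q x * φ x) ν) :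
    bip ν (fun x => Real.exp (-q x)) (fun x => c * Real.exp (-φ x)) =
      (∫ x, q x * φ x ∂ν) - (∫ x, q x ∂ν) * ∫ x, φ x ∂ν := by
  have hl : ∀ x, Real.log (c * Real.exp (-φ x)) = Real.log c - φ x := fun x => by
    rw [Real.log_mul hc.ne' (Real.exp_pos _).ne', Real.log_exp, sub_eq_add_neg]
  have hm : ∀ x, -q x * (Real.log c - φ x) = q x * φ x - Real.log c * q x := fun x => by ring
  simp only [bip, hl, Real.log_exp, hm]
  rw [integral_sub hqφ (hq.const_mul _), integral_sub (integrable_const _) hφ, integral_neg,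
    integral_const_mul]
  simp
  ring

/-- **Projection onto the indefinite-Gaussian subspace.**  The Bayes-space projection of
`p = c·exp (-φ)` onto the indefinite-Gaussian subspace `G` with Gaussian measure
`ν = N(μ, Σ)`, `Σ = LLᵀ`, i.e. the Bayes-space linear combination
`⊕ᵢ ⟨g₁ᵢ,p⟩·g₁ᵢ ⊕ ⊕ₖ ⟨g₂ₖ,p⟩·g₂ₖ` of the orthonormal basis (with `⊕` pointwise product and
`·` powering), equals, up to a positive normalization constant,
`exp (−(x−μ)ᵀE_ν[∂φ/∂xᵀ] − (1/2)(x−μ)ᵀE_ν[∂²φ/∂xᵀ∂x](x−μ))`. -/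
theorem indefGaussian_projection (N M : ℕ) (hM : M = N * (N + 1) / 2)
    (μ : Fin N → ℝ) (L : Matrix (Fin N) (Fin N) ℝ) (hL : IsUnit L.det)
    (vech : Matrix (Fin N) (Fin N) ℝ → Fin M → ℝ)
    (D : Matrix (Fin N × Fin N) (Fin M) ℝ)
    (hD : ∀ A : Matrix (Fin N) (Fin N) ℝ, A.IsSymm →
      ∀ ij : Fin N × Fin N, (D.mulVec (vech A)) ij = A ij.1 ij.2)
    (R : Matrix (Fin M) (Fin M) ℝ) (hR : R * R = (2⁻¹ : ℝ) • (Dᵀ * D)) (hRs : R.IsSymm)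
    (c : ℝ) (hc : 0 < c) (φ : (Fin N → ℝ) → ℝ) (hφ : ContDiff ℝ 2 φ)
    (hint₁ : Integrable φ (gaussPi N μ (L * Lᵀ)))
    (hint₂ : ∀ i, Integrable (fun x => (L⁻¹.mulVec (x - μ)) i * φ x) (gaussPi N μ (L * Lᵀ)))
    (hint₃ : ∀ k, Integrable
      (fun x => (R.mulVec (vech (L⁻¹ * vecMulVec (x - μ) (x - μ) * (L⁻¹)ᵀ))) k * φ x)
      (gaussPi N μ (L * Lᵀ)))
    (hint₄ : ∀ j, Integrable (fun x => fderiv ℝ φ x (Pi.single j 1)) (gaussPi N μ (L * Lᵀ)))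
    (hint₅ : ∀ i j, Integrable
      (fun x => fderiv ℝ (fun y => fderiv ℝ φ y (Pi.single j 1)) x (Pi.single i 1))
      (gaussPi N μ (L * Lᵀ))) :
    ∃ k : ℝ, 0 < k ∧ ∀ x,
      (∏ i : Fin N, gOne N μ L i x ^
          bip (gaussPi N μ (L * Lᵀ)) (gOne N μ L i) (fun y => c * Real.exp (-(φ y)))) *
        (∏ l : Fin M, gTwo N M μ L vech R l x ^
          bip (gaussPi N μ (L * Lᵀ)) (gTwo N M μ L vech R l) (fun y => c * Real.exp (-(φ y)))) =
      k * Real.exp (-((x - μ) ⬝ᵥ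
            (fun j => ∫ y, fderiv ℝ φ y (Pi.single j 1) ∂(gaussPi N μ (L * Lᵀ)))
          + (1 / 2) * ((x - μ) ⬝ᵥ
            (Matrix.of fun i j => ∫ y,
              fderiv ℝ (fun z => fderiv ℝ φ z (Pi.single j 1)) y (Pi.single i 1)
                ∂(gaussPi N μ (L * Lᵀ))).mulVec (x - μ)))) := by
  have := isProbabilityMeasure_gaussPi μ hL
  set ν := gaussPi N μ (L * Lᵀ)
  set z : Fin N → (Fin N → ℝ) → ℝ := fun i x => (L⁻¹.mulVec (x - μ)) i with hz
  set Z : (Fin N → ℝ) → Matrix (Fin N) (Fin N) ℝ :=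
    fun x => L⁻¹ * vecMulVec (x - μ) (x - μ) * (L⁻¹)ᵀ with hZ_def
  set q : Fin M → (Fin N → ℝ) → ℝ := fun k x => (R.mulVec (vech (Z x))) k with hq_def
  have hZ : ∀ x i j, Z x i j = z i x * z j x := fun x i j => by
    simp only [hZ_def, mul_vecMulVec, vecMulVec_mul, vecMul_transpose, vecMulVec_apply, hz]
  have hZs : ∀ x, (Z x).IsSymm := fun x => by
    ext i j
    rw [transpose_apply, hZ, hZ, mul_comm]
  obtain ⟨T, hT⟩ := exists_vech_eq_mulVec hM hD
  have hR_vech : ∀ A : Matrix (Fin N) (Fin N) ℝ, A.IsSymm → ∀ k,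
      (R.mulVec (vech A)) k = ∑ ij : Fin N × Fin N, (R * T) k ij * A ij.1 ij.2 := fun A hA k => by
    rw [hT A hA, mulVec_mulVec]
    rfl
  have hq : ∀ k x, q k x = ∑ ij : Fin N × Fin N, (R * T) k ij * (z ij.1 x * z ij.2 x) :=
    fun k x => by simp only [hq_def, hR_vech _ (hZs x), hZ]
  have hzz : ∀ i j, Integrable (fun x => z i x * z j x) ν := integrable_whiten_mul_whiten μ hL
  have hzzφ : ∀ i j, Integrable (fun x => z i x * z j x * φ x) ν := fun i j => by
    let W : Matrix (Fin N) (Fin N) ℝ := Matrix.single i j 1 + Matrix.single j i 1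
    have hW : W.IsSymm := by
      simp [W, Matrix.IsSymm, add_comm]
    have e : ∀ x, z i x * z j x * φ x = ∑ k, (R.mulVec (vech W)) k * (q k x * φ x) := fun x => by
      have h := dotProduct_mulVec_vech hD hR hRs hW (hZs x)
      have h' : ∑ a, ∑ b, W a b * Z x a b = 2 * (z i x * z j x) := by
        simp [W, add_mul, Finset.sum_add_distrib, Matrix.single_apply, ite_and, hZ]
        ring
      rw [h', inv_mul_cancel_left₀ two_ne_zero] at h
      rw [← h, dotProduct, Finset.sum_mul]
      exact Finset.sum_congr rfl fun k _ => mul_assoc _ _ _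
    simp only [e]
    exact integrable_finsetSum _ fun k _ => (hint₃ k).const_mul _
  set g : Fin N → ℝ := fun j => ∫ y, fderiv ℝ φ y (Pi.single j 1) ∂ν
  set H : Matrix (Fin N) (Fin N) ℝ := Matrix.of fun i j => ∫ y,
    fderiv ℝ (fun z => fderiv ℝ φ z (Pi.single j 1)) y (Pi.single i 1) ∂ν
  let C : Matrix (Fin N) (Fin N) ℝ := Matrix.of fun i j =>
    (∫ x, z i x * z j x * φ x ∂ν) - (1 : Matrix (Fin N) (Fin N) ℝ) i j * ∫ x, φ x ∂ν
  have hCs : C.IsSymm := by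
    ext i j
    simp [C, mul_comm (z i _), Matrix.one_apply, eq_comm]
  have hCH : ∀ i j, C i j = L.col i ⬝ᵥ H.mulVec (L.col j) := fun i j => by
    have h := fun v w => integral_fderiv_fderiv_col_gaussPi μ hφ hint₅ v w
    rw [← (h _ _).2]
    exact (integral_fderiv_fderiv_gaussPi μ hL i j hφ hint₁ hint₂ (hzzφ i j)
      (integral_fderiv_col_gaussPi μ hint₄ _).1 (h _ _).1).symm
  have hα₁ : ∀ i, bip ν (gOne N μ L i) (fun y => c * Real.exp (-(φ y))) = L.col i ⬝ᵥ g :=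
    fun i => by
    have h := integral_fderiv_col_gaussPi μ hint₄ (L.col i)
    refine (bip_exp_neg ν hc (integrable_whiten μ hL i) hint₁ (hint₂ i)).trans ?_
    rw [integral_whiten μ hL, zero_mul, sub_zero, ← integral_fderiv_gaussPi μ hL i
      (hφ.differentiable two_ne_zero) hint₁ (hint₂ i) h.1, h.2]
    rfl
  have hα₂ : ∀ k, bip ν (gTwo N M μ L vech R k) (fun y => c * Real.exp (-(φ y))) =
      (R.mulVec (vech C)) k := fun k => by
    have hqi : Integrable (q k) ν := by
      simp only [funext (hq k)]
      exact integrable_finsetSum _ fun ij _ => (hzz _ _).const_mul _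
    refine (bip_exp_neg ν hc hqi hint₁ (hint₃ k)).trans ?_
    have e1 : ∫ x, q k x * φ x ∂ν =
        ∑ ij : Fin N × Fin N, (R * T) k ij * ∫ x, z ij.1 x * z ij.2 x * φ x ∂ν := by
      simp only [hq, Finset.sum_mul, mul_assoc ((R * T) k _)]
      rw [integral_finsetSum _ fun ij _ => (hzzφ _ _).const_mul _]
      simp only [integral_const_mul]
    have e2 : ∫ x, q k x ∂ν =
        ∑ ij : Fin N × Fin N, (R * T) k ij * (1 : Matrix (Fin N) (Fin N) ℝ) ij.1 ij.2 := by
      simp only [hq]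
      rw [integral_finsetSum _ fun ij _ => (hzz _ _).const_mul _]
      simp only [integral_const_mul]
      exact Finset.sum_congr rfl fun ij _ =>
        congrArg _ (integral_whiten_mul_whiten μ hL ij.1 ij.2)
    rw [e1, e2, hR_vech C hCs, Finset.sum_mul, ← Finset.sum_sub_distrib]
    refine Finset.sum_congr rfl fun ij _ => ?_
    simp only [C, Matrix.of_apply]
    ring
  refine ⟨1, one_pos, fun x => ?_⟩
  have hLz : ∑ i, z i x • L.col i = x - μ := by
    have : L.mulVec (L⁻¹.mulVec (x - μ)) = x - μ := by
      rw [mulVec_mulVec, Matrix.mul_nonsing_inv L hL, one_mulVec]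
    conv_rhs => rw [← this, mulVec_eq_sum]
    simp only [op_smul_eq_smul]
    rfl
  have h1 : ∑ i, z i x * (L.col i ⬝ᵥ g) = (x - μ) ⬝ᵥ g := by
    rw [← hLz, sum_dotProduct]
    simp only [smul_dotProduct, smul_eq_mul]
  have h2 : ∑ k, q k x * (R.mulVec (vech C)) k = 1 / 2 * ((x - μ) ⬝ᵥ H.mulVec (x - μ)) := by
    refine (dotProduct_mulVec_vech hD hR hRs (hZs x) hCs).trans ?_
    rw [← hLz, sum_dotProduct, one_div]
    congr 1
    refine Finset.sum_congr rfl fun i _ => ?_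
    rw [mulVec_sum, dotProduct_sum]
    refine Finset.sum_congr rfl fun j _ => ?_
    rw [hZ, hCH, mulVec_smul, smul_dotProduct, dotProduct_smul, smul_eq_mul, smul_eq_mul, mul_assoc]
  simp only [hα₁, hα₂]
  have e1 : ∀ i, gOne N μ L i x ^ (L.col i ⬝ᵥ g) = Real.exp (-(z i x * (L.col i ⬝ᵥ g))) :=
    fun i => by rw [gOne, ← Real.exp_mul, neg_mul]
  have e2 : ∀ k, gTwo N M μ L vech R k x ^ (R.mulVec (vech C)) k =
      Real.exp (-(q k x * (R.mulVec (vech C)) k)) :=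
    fun k => by rw [gTwo, ← Real.exp_mul, neg_mul]
  simp only [e1, e2]
  rw [← Real.exp_sum, ← Real.exp_sum, ← Real.exp_add, Finset.sum_neg_distrib,
    Finset.sum_neg_distrib, h1, h2, one_mul, neg_add]
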